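/- Approximate 2-local decomposition of near-identity unitaries (Lemma lem:pauli-based-decomp): There exists a universal constant C > 0 such that the following holds. Let n ≥ 1, d = 2^n, and let H be a d×d Hermitian matrix with spectral norm ε := ‖H‖ < (π/16)^(2n). Then there exist m ∈ ℕ with m ≤ 2^(C·n) and 2-local unitaries U_1, …, U_m on (ℂ²)^{⊗n} such that (1) ‖exp(iH) − U_m⋯U_1‖ ≤ C·d²·ε², and (2) Σ_{j=1}^m ‖I − U_j‖ ≤ C·n²·d²·ε^(1/(2n)). -/

import Mathlib

open scoped ComplexOrder Matrix Matrix.Norms.L2Operator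

/-- Euclidean norm of a complex vector. -/
noncomputable def enorm {I : Type*} [Fintype I] (u : I → ℂ) : ℝ :=
  Real.sqrt (∑ i, ‖u i‖ ^ 2)

/-- Standard Hermitian inner product, conjugate-linear in the first argument. -/
noncomputable def ip {I : Type*} [Fintype I] (u v : I → ℂ) : ℂ :=
  ∑ i, (starRingEnd ℂ) (u i) * v i

/-- A unitary on `n` qubits is 2-local if it acts as a unitary `V` on two qubits `i, j`
and as the identity elsewhere. -/
def IsTwoLocalUnitary {n : ℕ} (U : Matrix (Fin n → Fin 2) (Fin n → Fin 2) ℂ) : Prop :=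
  Uᴴ * U = 1 ∧ U * Uᴴ = 1 ∧
  ∃ (i j : Fin n) (V : Matrix (Fin 2 × Fin 2) (Fin 2 × Fin 2) ℂ),
    Vᴴ * V = 1 ∧ V * Vᴴ = 1 ∧
    ∀ x y : Fin n → Fin 2,
      U x y = if ∀ k, k ≠ i → k ≠ j → x k = y k then V (x i, x j) (y i, y j) else 0

/-- `seqApply U ψ k = U_{k-1} ⋯ U_1 U_0 ψ` (0-based indexing of the gates). -/
noncomputable def seqApply {I : Type*} [Fintype I] (U : ℕ → Matrix I I ℂ) (ψ : I → ℂ) :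
    ℕ → (I → ℂ)
  | 0 => ψ
  | (k + 1) => (U k).mulVec (seqApply U ψ k)


/-- `seqProd U m = U_{m-1} ⋯ U_1 U_0` (0-based indexing of the factors). -/
noncomputable def seqProd {I : Type*} [Fintype I] [DecidableEq I] (U : ℕ → Matrix I I ℂ) :
    ℕ → Matrix I I ℂ
  | 0 => 1
  | (k + 1) => U k * seqProd U k

noncomputable def rot {R : Type*} [Ring R] [Algebra ℂ R] (P : R) (t : ℝ) : R :=
  (Real.cos t : ℂ) • (1 : R) + (Complex.I * (Real.sin t : ℂ)) • P

lemma rot_mul_neg {R : Type*} [Ring R] [Algebra ℂ R] (P : R) (hP : P * P = 1) (t : ℝ) :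
    rot P t * rot P (-t) = 1 := by
  have h : ((Real.sin t : ℂ))^2 + ((Real.cos t : ℂ))^2 = 1 := by
    exact_mod_cast Real.sin_sq_add_cos_sq t
  unfold rot
  rw [Real.cos_neg, Real.sin_neg]
  push_cast at h ⊢
  simp only [mul_add, add_mul, smul_mul_smul_comm, mul_one, one_mul, hP]
  have : Complex.I * Complex.I = -1 := Complex.I_mul_I
  match_scalars
  · linear_combination h - (Complex.sin t)^2 * this
  · ring

lemma rot_comm4 {R : Type*} [Ring R] [Algebra ℂ R] (A B C : R) (hA : A * A = 1) (hB : B * B = 1)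
    (hBA : B * A = -(A * B)) (hC : C = Complex.I • (A * B)) (a b a' β γ : ℝ)
    (h1 : Real.cos b * Real.cos (a + a') = Real.cos γ * Real.cos β)
    (h2 : Real.cos b * Real.sin (a + a') = - (Real.sin γ * Real.sin β))
    (h3 : Real.sin b * Real.cos (a - a') = Real.cos γ * Real.sin β)
    (h4 : Real.sin b * Real.sin (a - a') = Real.sin γ * Real.cos β) :
    rot A a * rot B b * rot A a' * rot B (-β) = rot C γ := by
  have key : rot A a * rot B b * rot A a' = rot C γ * rot B β := by
    rw [Real.cos_add] at h1
    rw [Real.sin_add] at h2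
    rw [Real.cos_sub] at h3
    rw [Real.sin_sub] at h4
    replace h1 := congrArg (Complex.ofReal) h1
    replace h2 := congrArg (Complex.ofReal) h2
    replace h3 := congrArg (Complex.ofReal) h3
    replace h4 := congrArg (Complex.ofReal) h4
    have hABA : A * B * A = - B := by rw [mul_assoc, hBA, mul_neg, ← mul_assoc, hA, one_mul]
    have hABB : A * B * B = A := by rw [mul_assoc, hB, mul_one]
    unfold rot
    subst hC
    push_cast at h1 h2 h3 h4 ⊢
    simp only [mul_add, add_mul, mul_one, one_mul, hA, hABA, hBA, smul_mul_assoc, mul_smul_comm, smul_neg, hABB]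
    have : Complex.I * Complex.I = -1 := Complex.I_mul_I
    match_scalars
    · linear_combination h1 + (Complex.cos b * Complex.sin a * Complex.sin a')*this
    · linear_combination Complex.I * h2 - Complex.I * (Complex.sin γ * Complex.sin β)*this
    · linear_combination Complex.I * h3 - Complex.I * (Complex.sin b * Complex.sin a * Complex.sin a')*this
    · linear_combination -h4 + (Complex.sin b * Complex.sin a * Complex.cos a' - Complex.sin b * Complex.cos a * Complex.sin a' - Complex.sin γ * Complex.cos β)*this
  rw [key, mul_assoc, rot_mul_neg B hB, mul_one]

set_option maxHeartbeats 1000000 in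
lemma angles_pos (γ : ℝ) (h0 : 0 ≤ γ) (hγ : γ ≤ Real.pi / 2) : ∃ a b a' β : ℝ,
    (Real.cos b * Real.cos (a + a') = Real.cos γ * Real.cos β ∧
    Real.cos b * Real.sin (a + a') = - (Real.sin γ * Real.sin β) ∧
    Real.sin b * Real.cos (a - a') = Real.cos γ * Real.sin β ∧
    Real.sin b * Real.sin (a - a') = Real.sin γ * Real.cos β) ∧
    (|a| ≤ Real.pi / 2 ∧ |b| ≤ Real.pi / 2 ∧ |a'| ≤ Real.pi / 2 ∧ |β| ≤ Real.pi / 2) ∧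
    (|a| ≤ 4 * √γ ∧ |b| ≤ 4 * √γ ∧ |a'| ≤ 4 * √γ ∧ |β| ≤ 4 * √γ) := by
  have hpi := Real.pi_pos
  have hpi3 := Real.pi_gt_three
  have hpi4 := Real.pi_lt_d2
  rcases le_or_gt γ (1/4) with hs | hs
  swap
  · have hq : 1/2 ≤ √γ := by apply Real.le_sqrt_of_sq_le; norm_num; linarith
    refine ⟨Real.pi/4, γ, -(Real.pi/4), 0, ?_, ?_, ?_⟩
    · rw [show Real.pi/4 - -(Real.pi/4) = Real.pi/2 by ring]
      simp
    · rw [abs_neg, abs_of_pos (by positivity : 0 < Real.pi/4), abs_of_nonneg h0]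
      simp only [abs_zero]
      refine ⟨?_, ?_, ?_, ?_⟩ <;> linarith
    · rw [abs_neg, abs_of_pos (by positivity : 0 < Real.pi/4), abs_of_nonneg h0]
      simp only [abs_zero]
      refine ⟨?_, ?_, ?_, ?_⟩ <;> linarith
  rcases h0.eq_or_lt with h0 | h0
  · subst h0
    exact ⟨0, 0, 0, 0, by simp, by simp; positivity, by simp⟩
  obtain ⟨t, ht0, htγ, hts⟩ : ∃ t : ℝ, 0 < t ∧ γ = t^2 ∧ √γ = t :=
    ⟨√γ, Real.sqrt_pos.2 h0, (Real.sq_sqrt h0.le).symm, rfl⟩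
  rw [hts]
  have ht2 : t ≤ 1/2 := by nlinarith
  have hsg0 : 0 < Real.sin γ := Real.sin_pos_of_pos_of_lt_pi h0 (by linarith)
  have hsg : Real.sin γ ≤ t^2 := by rw [← htγ]; exact Real.sin_le h0.le
  have hcg : 31/32 ≤ Real.cos γ := by
    have := Real.one_sub_sq_div_two_le_cos (x := γ); nlinarith
  have hcg1 := Real.cos_le_one γ
  have hst : Real.sin t ≤ t := Real.sin_le ht0.le
  have hst2 : 15/16 * t ≤ Real.sin t := by
    have := Real.sin_gt_sub_cube ht0
    have h2 : t^2 ≤ 1/4 := by nlinarith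
    nlinarith
  have hct : 7/8 ≤ Real.cos t := by
    have := Real.one_sub_sq_div_two_le_cos (x := t); nlinarith
  have hct1 := Real.cos_le_one t
  have hst0 : 0 < Real.sin t := by nlinarith
  have argb : ∀ x y M : ℝ, 0 < x → |y| ≤ M * x → |Complex.arg ⟨x, y⟩| ≤ M := by
    intro x y M hx hy
    have hlt : |Complex.arg ⟨x, y⟩| < Real.pi/2 := Complex.abs_arg_lt_pi_div_two_iff.2 (Or.inl hx)
    have htan : Real.tan (Complex.arg ⟨x,y⟩) = y / x := by simp [Complex.tan_arg]
    have hM : |y / x| ≤ M := by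
      rw [abs_div, abs_of_pos hx, div_le_iff₀ hx]; exact hy
    refine le_trans ?_ hM
    rw [← htan]
    rcases le_or_gt 0 (Complex.arg ⟨x, y⟩) with h | h
    · rw [abs_of_nonneg h] at hlt ⊢
      exact (Real.le_tan h hlt).trans (le_abs_self _)
    · rw [abs_of_neg h] at hlt ⊢
      have := Real.le_tan (by linarith : 0 ≤ -Complex.arg ⟨x, y⟩) hlt
      rw [Real.tan_neg] at this
      exact this.trans (neg_le_abs _)
  have p1 := Real.sin_sq_add_cos_sq γ
  have p2 := Real.sin_sq_add_cos_sq t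
  generalize Real.sin γ = sg at *
  generalize Real.cos γ = cg at *
  generalize Est : Real.sin t = st at *
  generalize Ect : Real.cos t = ct at *
  obtain ⟨σ, hσ⟩ : ∃ σ, σ = Complex.arg ⟨cg * ct, -(sg * st)⟩ := ⟨_, rfl⟩
  obtain ⟨τ, hτ⟩ : ∃ σ, σ = Complex.arg ⟨cg * st, sg * ct⟩ := ⟨_, rfl⟩
  have e1 := Complex.norm_mul_cos_arg ⟨cg * ct, -(sg * st)⟩
  have e2 := Complex.norm_mul_sin_arg ⟨cg * ct, -(sg * st)⟩
  have e3 := Complex.norm_mul_cos_arg ⟨cg * st, sg * ct⟩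
  have e4 := Complex.norm_mul_sin_arg ⟨cg * st, sg * ct⟩
  rw [← hσ] at e1 e2
  rw [← hτ] at e3 e4
  have n1 := Complex.sq_norm ⟨cg * ct, -(sg * st)⟩
  have n2 := Complex.sq_norm ⟨cg * st, sg * ct⟩
  have n10 := norm_nonneg (⟨cg * ct, -(sg * st)⟩ : ℂ)
  have n20 := norm_nonneg (⟨cg * st, sg * ct⟩ : ℂ)
  have bσ : |σ| ≤ t := by
    rw [hσ]; apply argb _ _ _ (by positivity)
    rw [abs_neg, abs_of_pos (by positivity)]
    have : sg * st ≤ t^2 * t := by gcongr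
    have h2 : (31/32) * (7/8) ≤ cg * ct := by gcongr
    nlinarith
  have bτ : |τ| ≤ 2 * t := by
    rw [hτ]; apply argb _ _ _ (by positivity)
    rw [abs_of_pos (by positivity)]
    have : sg * ct ≤ t^2 * 1 := by gcongr
    have h2 : (31/32) * (15/16*t) ≤ cg * st := by gcongr
    nlinarith
  generalize ‖(⟨cg * ct, -(sg * st)⟩ : ℂ)‖ = r1 at *
  generalize ‖(⟨cg * st, sg * ct⟩ : ℂ)‖ = r2 at *
  simp only [Complex.normSq_mk] at n1 n2
  have hr : r1^2 + r2^2 = 1 := by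
    rw [n1, n2]
    linear_combination (st^2+ct^2) * p1 + p2
  have hr2 : r2 ≤ 3/2 * t := by
    apply le_of_sq_le_sq _ (by positivity)
    have : sg * ct ≤ t^2 * 1 := by gcongr
    have h2 : cg * st ≤ 1 * t := by gcongr
    have h3 : (sg * ct)^2 ≤ (t^2 * 1)^2 := by gcongr
    have h4 : (cg * st)^2 ≤ (1*t)^2 := by gcongr
    have h5 : t^2 * t^2 ≤ 1/4 * t^2 := by gcongr; nlinarith
    have h6 : 0 ≤ t^2 := by positivity
    calc r2^2 = (cg*st)^2 + (sg*ct)^2 := by rw [n2]; ring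
      _ ≤ (1*t)^2 + (t^2*1)^2 := by linarith
      _ ≤ (3/2*t)^2 := by linarith
  have hb1 : Real.sin (Real.arcsin r2) = r2 := Real.sin_arcsin (by linarith) (by nlinarith)
  have hb2 : Real.cos (Real.arcsin r2) = r1 := by
    rw [Real.cos_arcsin, show 1 - r2^2 = r1^2 by linarith, Real.sqrt_sq n10]
  have hb0 : 0 ≤ Real.arcsin r2 := Real.arcsin_nonneg.2 n20
  have hb3 : Real.arcsin r2 ≤ Real.pi / 2 := Real.arcsin_le_pi_div_two _
  have hb4 : Real.arcsin r2 ≤ 4 * t := by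
    have := Real.mul_le_sin hb0 hb3
    rw [hb1, div_mul_eq_mul_div, div_le_iff₀ hpi] at this
    nlinarith
  have ha := abs_le.1 bσ
  have hb := abs_le.1 bτ
  refine ⟨(σ + τ)/2, Real.arcsin r2, (σ - τ)/2, t, ?_, ⟨?_, ?_, ?_, ?_⟩, ⟨?_, ?_, ?_, ?_⟩⟩
  · rw [show (σ + τ)/2 + (σ - τ)/2 = σ by ring, show (σ + τ)/2 - (σ - τ)/2 = τ by ring, hb1, hb2]
    rw [Est, Ect]; exact ⟨e1, e2, e3, e4⟩
  all_goals rw [abs_le]; constructor <;> linarith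

lemma angles (γ : ℝ) (hγ : |γ| ≤ Real.pi / 2) : ∃ a b a' β : ℝ,
    (Real.cos b * Real.cos (a + a') = Real.cos γ * Real.cos β ∧
    Real.cos b * Real.sin (a + a') = - (Real.sin γ * Real.sin β) ∧
    Real.sin b * Real.cos (a - a') = Real.cos γ * Real.sin β ∧
    Real.sin b * Real.sin (a - a') = Real.sin γ * Real.cos β) ∧
    (|a| ≤ Real.pi / 2 ∧ |b| ≤ Real.pi / 2 ∧ |a'| ≤ Real.pi / 2 ∧ |β| ≤ Real.pi / 2) ∧
    (|a| ≤ 4 * √|γ| ∧ |b| ≤ 4 * √|γ| ∧ |a'| ≤ 4 * √|γ| ∧ |β| ≤ 4 * √|γ|) := by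
  obtain ⟨a, b, a', β, ⟨h1, h2, h3, h4⟩, h⟩ := angles_pos |γ| (abs_nonneg _) hγ
  rcases le_or_gt 0 γ with h0 | h0
  · rw [abs_of_nonneg h0] at *
    exact ⟨a, b, a', β, ⟨h1, h2, h3, h4⟩, h⟩
  · refine ⟨a, -b, a', -β, ?_, by simpa using h⟩
    rw [abs_of_neg h0] at h1 h2 h3 h4
    simp only [Real.cos_neg, Real.sin_neg] at *
    refine ⟨h1, ?_, ?_, ?_⟩ <;> linarith

abbrev QM (n : ℕ) := Matrix (Fin n → Fin 2) (Fin n → Fin 2) ℂ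

noncomputable def pauli : Fin 4 → Matrix (Fin 2) (Fin 2) ℂ :=
  ![1, !![0, 1; 1, 0], !![0, -Complex.I; Complex.I, 0], !![1, 0; 0, -1]]

lemma pauli_herm (q : Fin 4) : (pauli q)ᴴ = pauli q := by
  fin_cases q <;> ext i j <;> fin_cases i <;> fin_cases j <;> simp [pauli]

lemma pauli_sq (q : Fin 4) : pauli q * pauli q = 1 := by
  fin_cases q <;> ext i j <;> fin_cases i <;> fin_cases j <;>
    simp [pauli, Matrix.mul_apply, Fin.sum_univ_two]

lemma pauli_split (q : Fin 4) (hq : q ≠ 0) : ∃ s t : Fin 4, s ≠ 0 ∧ t ≠ 0 ∧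
    pauli s * pauli t = (-Complex.I) • pauli q ∧ pauli t * pauli s = Complex.I • pauli q := by
  fin_cases q
  · exact absurd rfl hq
  · refine ⟨3, 2, by decide, by decide, ?_, ?_⟩ <;>
    ext i j <;> fin_cases i <;> fin_cases j <;>
      simp [pauli, Matrix.mul_apply, Fin.sum_univ_two]
  · refine ⟨1, 3, by decide, by decide, ?_, ?_⟩ <;>
    ext i j <;> fin_cases i <;> fin_cases j <;>
      simp [pauli, Matrix.mul_apply, Fin.sum_univ_two]
  · refine ⟨2, 1, by decide, by decide, ?_, ?_⟩ <;>
    ext i j <;> fin_cases i <;> fin_cases j <;>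
      simp [pauli, Matrix.mul_apply, Fin.sum_univ_two]

lemma pauli_complete (a b c e : Fin 2) :
    ∑ q : Fin 4, pauli q a b * pauli q c e = if a = e ∧ b = c then 2 else 0 := by
  fin_cases a <;> fin_cases b <;> fin_cases c <;> fin_cases e <;>
    simp [pauli, Fin.sum_univ_four] <;> norm_num

noncomputable def tens {n : ℕ} (M : Fin n → Matrix (Fin 2) (Fin 2) ℂ) : QM n :=
  Matrix.of fun u v => ∏ k, M k (u k) (v k)

lemma tens_apply {n : ℕ} (M : Fin n → Matrix (Fin 2) (Fin 2) ℂ) (u v : Fin n → Fin 2) :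
    tens M u v = ∏ k, M k (u k) (v k) := rfl

lemma tens_mul {n : ℕ} (M N : Fin n → Matrix (Fin 2) (Fin 2) ℂ) :
    tens M * tens N = tens (fun k => M k * N k) := by
  ext u v
  simp only [tens_apply, Matrix.mul_apply, ← Finset.prod_mul_distrib]
  rw [Finset.prod_univ_sum, Fintype.piFinset_univ]

lemma tens_one {n : ℕ} : tens (fun _ : Fin n => (1 : Matrix (Fin 2) (Fin 2) ℂ)) = 1 := by
  ext u v
  rw [tens_apply]
  simp only [Matrix.one_apply]
  rw [Finset.prod_ite_zero]
  simp [funext_iff]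

lemma tens_smul {n : ℕ} (c : Fin n → ℂ) (M : Fin n → Matrix (Fin 2) (Fin 2) ℂ) :
    tens (fun k => c k • M k) = (∏ k, c k) • tens M := by
  ext u v
  simp [tens_apply, Finset.prod_mul_distrib]

lemma tens_conjTranspose {n : ℕ} (M : Fin n → Matrix (Fin 2) (Fin 2) ℂ) :
    (tens M)ᴴ = tens (fun k => (M k)ᴴ) := by
  ext u v
  simp [tens_apply, Matrix.conjTranspose_apply]

noncomputable def PS {n : ℕ} (p : Fin n → Fin 4) : QM n := tens (fun k => pauli (p k))

lemma PS_herm {n : ℕ} (p : Fin n → Fin 4) : (PS p)ᴴ = PS p := by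
  simp [PS, tens_conjTranspose, pauli_herm]

lemma PS_sq {n : ℕ} (p : Fin n → Fin 4) : PS p * PS p = 1 := by
  simp [PS, tens_mul, pauli_sq, tens_one]

lemma PS_complete {n : ℕ} (u v u' v' : Fin n → Fin 2) :
    ∑ p : Fin n → Fin 4, PS p u v * PS p u' v' = if u = v' ∧ v = u' then (2:ℂ)^n else 0 := by
  simp only [PS, tens_apply, ← Finset.prod_mul_distrib]
  have := Finset.prod_univ_sum (fun _ : Fin n => (Finset.univ : Finset (Fin 4)))
    (fun k q => pauli q (u k) (v k) * pauli q (u' k) (v' k))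
  rw [Fintype.piFinset_univ] at this
  rw [← this]
  simp only [pauli_complete]
  rw [Finset.prod_ite_zero]
  simp [funext_iff, forall_and]

lemma PS_split {n : ℕ} (p : Fin n → Fin 4) (j : Fin n) (hj : p j ≠ 0) (S S' : Finset (Fin n))
    (hS : j ∉ S) (hS' : j ∉ S') (hd : Disjoint S S') (hp : ∀ k, k ≠ j → k ∉ S → k ∉ S' → p k = 0) :
    ∃ p1 p2 : Fin n → Fin 4, p1 j ≠ 0 ∧ p2 j ≠ 0 ∧ (∀ k, k ≠ j → k ∉ S → p1 k = 0) ∧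
      (∀ k, k ≠ j → k ∉ S' → p2 k = 0) ∧ PS p = Complex.I • (PS p1 * PS p2) ∧
      PS p2 * PS p1 = - (PS p1 * PS p2) := by
  obtain ⟨s, t, hs, ht, hst, hts⟩ := pauli_split (p j) hj
  have p0 : pauli 0 = 1 := rfl
  have e1 : PS (fun k => if k = j then s else if k ∈ S then p k else 0) *
      PS (fun k => if k = j then t else if k ∈ S' then p k else 0) = (-Complex.I) • PS p := by
    unfold PS
    rw [tens_mul]
    have := tens_smul (fun k => if k = j then -Complex.I else 1) (fun k => pauli (p k))
    rw [Finset.prod_ite_eq' ] at this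
    simp only [Finset.mem_univ, if_true] at this
    rw [← this]
    congr 1
    funext k
    by_cases hk : k = j
    · subst hk; simp [hst]
    · by_cases h1 : k ∈ S
      · have h2 : k ∉ S' := Finset.disjoint_left.1 hd h1
        simp [hk, h1, h2, p0]
      · by_cases h2 : k ∈ S'
        · simp [hk, h1, h2, p0]
        · simp [hk, h1, h2, p0, hp k hk h1 h2]
  have e2 : PS (fun k => if k = j then t else if k ∈ S' then p k else 0) *
      PS (fun k => if k = j then s else if k ∈ S then p k else 0) = (Complex.I) • PS p := by
    unfold PS
    rw [tens_mul]
    have := tens_smul (fun k => if k = j then Complex.I else 1) (fun k => pauli (p k))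
    rw [Finset.prod_ite_eq' ] at this
    simp only [Finset.mem_univ, if_true] at this
    rw [← this]
    congr 1
    funext k
    by_cases hk : k = j
    · subst hk; simp [hts]
    · by_cases h1 : k ∈ S
      · have h2 : k ∉ S' := Finset.disjoint_left.1 hd h1
        simp [hk, h1, h2, p0]
      · by_cases h2 : k ∈ S'
        · simp [hk, h1, h2, p0]
        · simp [hk, h1, h2, p0, hp k hk h1 h2]
  refine ⟨fun k => if k = j then s else if k ∈ S then p k else 0,
    fun k => if k = j then t else if k ∈ S' then p k else 0, ?_, ?_, ?_, ?_, ?_, ?_⟩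
  rotate_left 4
  · rw [e1, smul_smul]; simp
  · rw [e1, e2]; simp
  · simpa using hs
  · simpa using ht
  · intro k hk h; simp [hk, h]
  · intro k hk h; simp [hk, h]

lemma rot_conjTranspose {ι : Type*} [Fintype ι] [DecidableEq ι] (P : Matrix ι ι ℂ) (hP : Pᴴ = P)
    (t : ℝ) : (rot P t)ᴴ = rot P (-t) := by
  unfold rot
  rw [Matrix.conjTranspose_add, Matrix.conjTranspose_smul, Matrix.conjTranspose_smul, hP]
  simp [← Complex.ofReal_sin, ← Complex.ofReal_cos, Complex.conj_ofReal]

lemma rot_unitary {ι : Type*} [Fintype ι] [DecidableEq ι] (P : Matrix ι ι ℂ) (hP : Pᴴ = P)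
    (hP2 : P * P = 1) (t : ℝ) : (rot P t)ᴴ * rot P t = 1 ∧ rot P t * (rot P t)ᴴ = 1 := by
  rw [rot_conjTranspose P hP]
  refine ⟨?_, rot_mul_neg P hP2 t⟩
  have := rot_mul_neg P hP2 (-t)
  rwa [neg_neg] at this

lemma local_N {n : ℕ} (p : Fin n → Fin 4) (i j : Fin n) (hp : ∀ k, k ≠ i → k ≠ j → p k = 0) :
    ∃ N : Matrix (Fin 2 × Fin 2) (Fin 2 × Fin 2) ℂ, Nᴴ = N ∧ N * N = 1 ∧
      ∀ x y : Fin n → Fin 2, PS p x y =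
        if ∀ k, k ≠ i → k ≠ j → x k = y k then N (x i, x j) (y i, y j) else 0 := by
  have p0 : pauli 0 = 1 := rfl
  have hz : ∀ x y : Fin n → Fin 2, (¬ ∀ k, k ≠ i → k ≠ j → x k = y k) → PS p x y = 0 := by
    intro x y h
    push Not at h
    obtain ⟨k, hi, hj, hk⟩ := h
    rw [PS, tens_apply]
    apply Finset.prod_eq_zero (Finset.mem_univ k)
    rw [hp k hi hj, p0, Matrix.one_apply_ne hk]
  by_cases hij : i = j
  · subst hij
    have hh := pauli_herm (p i)
    have hq := pauli_sq (p i)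
    refine ⟨Matrix.of fun a b => if a.1 = a.2 then (if b.1 = b.2 then pauli (p i) a.1 b.1 else 0)
      else if a = b then 1 else 0, ?_, ?_, ?_⟩
    · ext ⟨a, a'⟩ ⟨b, b'⟩
      have h2 := congrFun (congrFun hh a) b
      rw [Matrix.conjTranspose_apply] at h2
      by_cases h : a = a' <;> by_cases h' : b = b' <;> simp [h, h']
      · subst h; subst h'; exact h2
      · grind
      · grind
      · simp [eq_comm]
    · ext ⟨a, a'⟩ ⟨b, b'⟩
      have h2 := congrFun (congrFun hq a) b
      rw [Matrix.mul_apply, Fin.sum_univ_two] at h2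
      rw [Matrix.mul_apply, Fintype.sum_prod_type]
      simp only [Fin.sum_univ_two, Matrix.of_apply]
      generalize pauli (p i) = M at *
      fin_cases a <;> fin_cases a' <;> fin_cases b <;> fin_cases b' <;> simp_all
    · intro x y
      split_ifs with h
      · rw [PS, tens_apply, Fintype.prod_eq_single i]
        · simp
        · intro k hk
          rw [hp k hk hk, p0, h k hk hk, Matrix.one_apply_eq]
      · exact hz x y h
  · refine ⟨Matrix.kroneckerMap (· * ·) (pauli (p i)) (pauli (p j)), ?_, ?_, ?_⟩
    · rw [Matrix.conjTranspose_kronecker, pauli_herm, pauli_herm]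
    · rw [← Matrix.mul_kronecker_mul, pauli_sq, pauli_sq, Matrix.one_kronecker_one]
    · intro x y
      split_ifs with h
      · rw [PS, tens_apply, Fintype.prod_eq_mul i j hij]
        · rfl
        · rintro k ⟨hk, hk'⟩
          rw [hp k hk hk', p0, h k hk hk', Matrix.one_apply_eq]
      · exact hz x y h

lemma rot_local {n : ℕ} (p : Fin n → Fin 4) (i j : Fin n) (hp : ∀ k, k ≠ i → k ≠ j → p k = 0)
    (t : ℝ) : IsTwoLocalUnitary (rot (PS p) t) := by
  obtain ⟨h1, h2⟩ := rot_unitary (PS p) (PS_herm p) (PS_sq p) t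
  obtain ⟨N, hN, hN2, hx⟩ := local_N p i j hp
  obtain ⟨h3, h4⟩ := rot_unitary N hN hN2 t
  refine ⟨h1, h2, i, j, rot N t, h3, h4, ?_⟩
  intro x y
  have hone : (1 : QM n) x y = if ∀ k, k ≠ i → k ≠ j → x k = y k then
      (1 : Matrix (Fin 2 × Fin 2) (Fin 2 × Fin 2) ℂ) (x i, x j) (y i, y j) else 0 := by
    split_ifs with h
    · rw [Matrix.one_apply, Matrix.one_apply]
      congr 1
      simp only [Prod.mk.injEq, eq_iff_iff]
      constructor
      · rintro rfl; simp
      · rintro ⟨a, b⟩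
        funext k
        by_cases hi : k = i
        · rw [hi, a]
        · by_cases hj : k = j
          · rw [hj, b]
          · exact h k hi hj
    · apply Matrix.one_apply_ne
      rintro rfl
      exact h (fun _ _ _ => rfl)
  have : rot (PS p) t x y = (Real.cos t : ℂ) * (1 : QM n) x y +
    (Complex.I * (Real.sin t : ℂ)) * PS p x y := rfl
  rw [this, hone, hx]
  split_ifs
  · rfl
  · simp

lemma PS_norm {n : ℕ} (p : Fin n → Fin 4) : ‖PS p‖ ≤ 1 := by
  have h := CStarRing.norm_star_mul_self (x := PS p)
  rw [Matrix.star_eq_conjTranspose, PS_herm, PS_sq, norm_one] at h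
  nlinarith [norm_nonneg (PS p)]

lemma rot_norm {n : ℕ} (p : Fin n → Fin 4) (t : ℝ) : ‖rot (PS p) t‖ ≤ 1 := by
  have h := CStarRing.norm_star_mul_self (x := rot (PS p) t)
  rw [Matrix.star_eq_conjTranspose, (rot_unitary _ (PS_herm p) (PS_sq p) t).1, norm_one] at h
  nlinarith [norm_nonneg (rot (PS p) t)]

lemma cos_sub_abs (t : ℝ) : |Real.cos t - 1| ≤ t^2/2 := by
  rw [abs_le]
  have := Real.one_sub_sq_div_two_le_cos (x := t)
  have := Real.cos_le_one t
  constructor <;> nlinarith [sq_nonneg t]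

lemma rot_sub_one {n : ℕ} (p : Fin n → Fin 4) (t : ℝ) (ht : |t| ≤ Real.pi / 2) :
    ‖1 - rot (PS p) t‖ ≤ 2 * |t| := by
  have e : rot (PS p) t - 1 = ((Real.cos t - 1 : ℝ) : ℂ) • (1 : QM n) +
      (Complex.I * (Real.sin t : ℂ)) • PS p := by
    unfold rot; push_cast; module
  rw [norm_sub_rev, e]
  refine (norm_add_le _ _).trans ?_
  rw [norm_smul, norm_smul, norm_mul, Complex.norm_I, one_mul, Complex.norm_real, Complex.norm_real,
    norm_one, Real.norm_eq_abs, Real.norm_eq_abs]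
  have h1 := cos_sub_abs t
  have h2 : |Real.sin t| ≤ |t| := Real.abs_sin_le_abs
  have h3 := PS_norm p
  have h4 : |Real.sin t| * ‖PS p‖ ≤ |t| * 1 := by gcongr
  have h5 := Real.pi_lt_d2
  have h6 : t^2 = |t| * |t| := by rw [← sq, sq_abs]
  nlinarith [abs_nonneg t]

lemma rot_sub_two {n : ℕ} (p : Fin n → Fin 4) (t : ℝ) (ht : |t| ≤ 1) :
    ‖rot (PS p) t - 1 - (Complex.I * t) • PS p‖ ≤ |t| ^ 2 := by
  have e : rot (PS p) t - 1 - (Complex.I * t) • PS p = ((Real.cos t - 1 : ℝ) : ℂ) • (1 : QM n) +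
      (Complex.I * ((Real.sin t - t : ℝ) : ℂ)) • PS p := by
    unfold rot; push_cast; module
  rw [e]
  refine (norm_add_le _ _).trans ?_
  rw [norm_smul, norm_smul, norm_mul, Complex.norm_I, one_mul, Complex.norm_real, Complex.norm_real,
    norm_one, Real.norm_eq_abs, Real.norm_eq_abs]
  have h1 := cos_sub_abs t
  have h2 : |Real.sin t - t| ≤ |t|^2 / 2 := by
    wlog h0 : 0 < t generalizing t
    · rcases eq_or_lt_of_le (not_lt.1 h0) with h | h
      · simp [h]
      · have := this (-t) (by simpa using ht) ((by unfold rot; push_cast; module)) (cos_sub_abs _) (by linarith)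
        rw [Real.sin_neg, abs_neg, ← abs_neg] at this
        convert this using 2
        ring
    rw [abs_of_pos h0] at ht ⊢
    have a1 := Real.sin_gt_sub_cube h0
    have a2 := Real.sin_le h0.le
    rw [abs_le]
    have : t^3 ≤ t^2 := pow_le_pow_of_le_one h0.le ht (by norm_num)
    constructor <;> nlinarith
  have h3 := PS_norm p
  have h4 : |Real.sin t - t| * ‖PS p‖ ≤ |t|^2/2 * 1 := by gcongr
  have h6 : t^2 = |t|^2 := by rw [sq_abs]
  nlinarith [abs_nonneg t]

lemma seqProd_congr {I : Type*} [Fintype I] [DecidableEq I] (U U' : ℕ → Matrix I I ℂ) (m : ℕ)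
    (h : ∀ k < m, U k = U' k) : seqProd U m = seqProd U' m := by
  induction m with
  | zero => rfl
  | succ m ih =>
    simp only [seqProd]
    rw [h m (by omega), ih (fun k hk => h k (by omega))]

lemma exists_seq {I : Type*} [Fintype I] [DecidableEq I] (L : List (Matrix I I ℂ)) :
    ∃ U : ℕ → Matrix I I ℂ, seqProd U L.length = L.prod ∧ ∀ i < L.length, U i ∈ L := by
  induction L with
  | nil => exact ⟨fun _ => 1, rfl, by simp⟩
  | cons a L ih =>
    obtain ⟨U, h1, h2⟩ := ih
    refine ⟨fun k => if k = L.length then a else U k, ?_, ?_⟩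
    · simp only [List.length_cons, seqProd, if_true, List.prod_cons]
      rw [← h1]
      congr 1
      apply seqProd_congr
      intro k hk
      rw [if_neg (by omega)]
    · intro i hi
      rw [List.length_cons] at hi
      by_cases h : i = L.length
      · simp [h]
      · simp only [h, if_false]
        exact List.mem_cons_of_mem _ (h2 i (by omega))

lemma rec_gate {n : ℕ} (r : ℕ) : ∀ (p : Fin n → Fin 4) (j : Fin n) (S : Finset (Fin n)) (θ δ : ℝ),
    p j ≠ 0 → j ∉ S → S.card ≤ 2 ^ r → (∀ k, k ≠ j → k ∉ S → p k = 0) → |θ| ≤ Real.pi / 2 →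
    0 ≤ δ → |θ| ≤ 16 * δ ^ (2 ^ r) →
    ∃ L : List (QM n), L.prod = rot (PS p) θ ∧ L.length ≤ 4 ^ r ∧
      ∀ g ∈ L, IsTwoLocalUnitary g ∧ ‖1 - g‖ ≤ 32 * δ := by
  induction r with
  | zero =>
    intro p j S θ δ hj hjS hS hp hθ hδ hθδ
    have hloc : ∃ i, ∀ k, k ≠ i → k ≠ j → p k = 0 := by
      rcases S.eq_empty_or_nonempty with h | ⟨i, hi⟩
      · refine ⟨j, fun k hk _ => hp k hk (by simp [h])⟩
      · refine ⟨i, fun k hk hkj => hp k hkj ?_⟩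
        intro hkS
        rw [pow_zero, Finset.card_le_one] at hS
        exact hk (hS k hkS i hi)
    obtain ⟨i, hi⟩ := hloc
    refine ⟨[rot (PS p) θ], by simp, by simp, ?_⟩
    intro g hg
    rw [List.mem_singleton] at hg
    subst hg
    refine ⟨rot_local p i j hi θ, (rot_sub_one p θ hθ).trans ?_⟩
    rw [pow_zero, pow_one] at hθδ
    linarith
  | succ r ih =>
    intro p j S θ δ hj hjS hS hp hθ hδ hθδ
    obtain ⟨S1, hS1, hc1⟩ := Finset.exists_subset_card_eq (s := S) (n := S.card / 2) (by omega)
    have hc2 := Finset.card_sdiff_add_card_eq_card hS1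
    have hd : Disjoint S1 (S \ S1) := Finset.disjoint_sdiff
    rw [pow_succ] at hS
    obtain ⟨p1, p2, h1, h2, h3, h4, h5, h6⟩ := PS_split p j hj S1 (S \ S1) (fun h => hjS (hS1 h))
      (fun h => hjS (Finset.sdiff_subset h)) hd
      (fun k hk ha hb => hp k hk (fun h => hb (Finset.mem_sdiff.2 ⟨h, ha⟩)))
    obtain ⟨a, b, a', β, ⟨e1, e2, e3, e4⟩, ⟨b1, b2, b3, b4⟩, ⟨c1, c2, c3, c4⟩⟩ := angles θ hθ
    have hsq : 4 * √|θ| ≤ 16 * δ ^ 2 ^ r := by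
      have : √|θ| ≤ 4 * δ ^ 2 ^ r := by
        rw [Real.sqrt_le_left (by positivity)]
        refine hθδ.trans (le_of_eq ?_)
        rw [mul_pow, ← pow_mul, pow_succ]; norm_num
      linarith
    have hcard1 : S1.card ≤ 2 ^ r := by omega
    have hcard2 : (S \ S1).card ≤ 2 ^ r := by omega
    have hj1 : j ∉ S1 := fun h => hjS (hS1 h)
    have hj2 : j ∉ S \ S1 := fun h => hjS (Finset.sdiff_subset h)
    obtain ⟨L1, x1, y1, z1⟩ := ih p1 j S1 a δ h1 hj1 hcard1 h3 b1 hδ (c1.trans hsq)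
    obtain ⟨L2, x2, y2, z2⟩ := ih p2 j (S \ S1) b δ h2 hj2 hcard2 h4 b2 hδ (c2.trans hsq)
    obtain ⟨L3, x3, y3, z3⟩ := ih p1 j S1 a' δ h1 hj1 hcard1 h3 b3 hδ (c3.trans hsq)
    obtain ⟨L4, x4, y4, z4⟩ := ih p2 j (S \ S1) (-β) δ h2 hj2 hcard2 h4 (by rwa [abs_neg]) hδ
      (by rw [abs_neg]; exact c4.trans hsq)
    refine ⟨L1 ++ L2 ++ L3 ++ L4, ?_, ?_, ?_⟩
    · simp only [List.prod_append, x1, x2, x3, x4]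
      exact rot_comm4 (PS p1) (PS p2) (PS p) (PS_sq p1) (PS_sq p2) h6 h5 a b a' β θ e1 e2 e3 e4
    · simp only [List.length_append, pow_succ]; omega
    · intro g hg
      simp only [List.mem_append] at hg
      rcases hg with ((hg | hg) | hg) | hg
      · exact z1 g hg
      · exact z2 g hg
      · exact z3 g hg
      · exact z4 g hg

lemma clog_bound (n : ℕ) (hn : 1 ≤ n) : 2 ^ Nat.clog 2 n ≤ 2 * n := by
  rcases hn.eq_or_lt with h | h
  · subst h; simp
  · have h1 := Nat.pow_pred_clog_lt_self (b := 2) (by norm_num) h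
    have h2 : 0 < Nat.clog 2 n := Nat.clog_pos (by norm_num) h
    obtain ⟨m, hm⟩ : ∃ m, Nat.clog 2 n = m + 1 := ⟨Nat.clog 2 n - 1, by omega⟩
    rw [hm] at h1 ⊢
    simp only [Nat.pred_succ, Nat.pred_eq_sub_one, Nat.add_sub_cancel] at h1
    rw [pow_succ]; omega

lemma pauli_gate {n : ℕ} (hn : 1 ≤ n) (p : Fin n → Fin 4) (θ δ : ℝ) (hδ : 0 ≤ δ) (hδ1 : δ ≤ 1)
    (hθ : |θ| ≤ δ ^ (2 * n)) :
    ∃ L : List (QM n), L.prod = rot (PS p) θ ∧ L.length ≤ 4 * n ^ 2 ∧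
      ∀ g ∈ L, IsTwoLocalUnitary g ∧ ‖1 - g‖ ≤ 32 * δ := by
  have hpi : |θ| ≤ Real.pi / 2 := by
    have := Real.pi_gt_three
    have := pow_le_one₀ (n := 2 * n) hδ hδ1
    linarith
  by_cases h : ∃ j, p j ≠ 0
  · obtain ⟨j, hj⟩ := h
    obtain ⟨L, h1, h2, h3⟩ := rec_gate (Nat.clog 2 n) p j (Finset.univ.erase j) θ δ hj (by simp)
      (by
        have := Nat.le_pow_clog (b := 2) (by norm_num) n
        rw [Finset.card_erase_of_mem (Finset.mem_univ _), Finset.card_fin]; omega)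
      (by intro k hk hk'; simp [hk] at hk') hpi hδ
      (by
        have h1 : δ ^ (2 * n) ≤ δ ^ (2 ^ Nat.clog 2 n) :=
          pow_le_pow_of_le_one hδ hδ1 (clog_bound n hn)
        have h2 : 0 ≤ δ ^ (2 ^ Nat.clog 2 n) := by positivity
        linarith)
    refine ⟨L, h1, h2.trans ?_, h3⟩
    calc 4 ^ Nat.clog 2 n = (2 ^ Nat.clog 2 n) ^ 2 := by rw [← pow_mul, mul_comm, pow_mul]; norm_num
      _ ≤ (2 * n) ^ 2 := Nat.pow_le_pow_left (clog_bound n hn) 2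
      _ = 4 * n ^ 2 := by ring
  · push Not at h
    refine ⟨[rot (PS p) θ], by simp, by simp; nlinarith, ?_⟩
    intro g hg
    rw [List.mem_singleton] at hg
    subst hg
    refine ⟨rot_local p ⟨0, hn⟩ ⟨0, hn⟩ (fun k _ _ => h k) θ, (rot_sub_one p θ hpi).trans ?_⟩
    have : δ ^ (2 * n) ≤ δ := pow_le_of_le_one hδ hδ1 (by omega)
    linarith

lemma trotter {n : ℕ} (a : (Fin n → Fin 4) → ℝ) (ha : ∀ p, |a p| ≤ 1) (l : List (Fin n → Fin 4)) :
    ‖(l.map fun p => rot (PS p) (a p)).prod - 1 - (l.map fun p => (Complex.I * a p) • PS p).sum‖ ≤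
      ((l.map fun p => |a p|).sum) ^ 2 ∧
    ‖(l.map fun p => (Complex.I * a p) • PS p).sum‖ ≤ (l.map fun p => |a p|).sum := by
  induction l with
  | nil => simp
  | cons p l ih =>
    obtain ⟨h1, h2⟩ := ih
    simp only [List.map_cons, List.prod_cons, List.sum_cons]
    have hX : ‖(Complex.I * (a p : ℂ)) • PS p‖ ≤ |a p| := by
      rw [norm_smul, norm_mul, Complex.norm_I, one_mul, Complex.norm_real, Real.norm_eq_abs]
      exact mul_le_of_le_one_right (abs_nonneg _) (PS_norm p)
    refine ⟨?_, (norm_add_le _ _).trans (by gcongr)⟩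
    have r1 := rot_norm p (a p)
    have r2 := rot_sub_one p (a p) (by have := Real.pi_gt_three; have := ha p; linarith)
    rw [norm_sub_rev] at r2
    have r3 := rot_sub_two p (a p) (ha p)
    generalize (l.map fun p => rot (PS p) (a p)).prod = Q at *
    generalize (l.map fun p => (Complex.I * (a p : ℂ)) • PS p).sum = Y at *
    generalize (l.map fun p => |a p|).sum = s at *
    generalize rot (PS p) (a p) = R at *
    generalize (Complex.I * (a p : ℂ)) • PS p = X at *
    generalize |a p| = t at *
    have e : R * Q - 1 - (X + Y) = R * (Q - 1 - Y) + (R - 1 - X) + (R - 1) * Y := by noncomm_ring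
    rw [e]
    calc _ ≤ ‖R * (Q - 1 - Y)‖ + ‖R - 1 - X‖ + ‖(R - 1) * Y‖ := norm_add₃_le
      _ ≤ ‖R‖ * ‖Q - 1 - Y‖ + ‖R - 1 - X‖ + ‖R - 1‖ * ‖Y‖ := by
        gcongr <;> exact norm_mul_le _ _
      _ ≤ 1 * s ^ 2 + t ^ 2 + (2 * t) * s := by
        have := norm_nonneg (R - 1)
        gcongr
        linarith
      _ = (t + s) ^ 2 := by ring

lemma exp_second {n : ℕ} (X : QM n) (hX : ‖X‖ ≤ 1) :
    ‖NormedSpace.exp X - 1 - X‖ ≤ ‖X‖ ^ 2 := by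
  have h1 := NormedSpace.exp_series_hasSum_exp' (𝕂 := ℂ) X
  have h2 := NormedSpace.exp_series_hasSum_exp' (𝕂 := ℝ) ‖X‖
  rw [← hasSum_nat_add_iff' 2] at h1 h2
  have h3 := h1.norm_le_of_bounded h2 (fun k => by
    rw [norm_smul, smul_eq_mul]
    gcongr
    · simp
    · exact norm_pow_le _ _)
  simp only [Finset.sum_range_succ, Finset.sum_range_zero] at h3
  simp only [Nat.factorial, pow_zero, pow_one, Nat.cast_one, inv_one, one_smul, zero_add, mul_one] at h3
  rw [sub_sub]
  refine h3.trans ?_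
  rw [← Real.exp_eq_exp_ℝ, ← sub_sub]
  exact (le_abs_self _).trans (Real.abs_exp_sub_one_sub_id_le (by rwa [abs_norm]))

lemma entry_le {n : ℕ} (M : QM n) (x : Fin n → Fin 2) : ‖M x x‖ ≤ ‖M‖ := by
  have h := Matrix.l2_opNorm_mulVec M (EuclideanSpace.single x 1)
  have h2 := PiLp.norm_apply_le (WithLp.toLp 2 (M *ᵥ (EuclideanSpace.single x (1:ℂ)).ofLp)) x
  simp at h h2
  exact h2.trans h

noncomputable def coef {n : ℕ} (H : QM n) (p : Fin n → Fin 4) : ℝ :=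
  (Matrix.trace (PS p * H)).re / 2 ^ n

lemma coef_eq {n : ℕ} (H : QM n) (hH : H.IsHermitian) (p : Fin n → Fin 4) :
    Matrix.trace (PS p * H) = 2 ^ n * (coef H p : ℂ) := by
  have h : (starRingEnd ℂ) (Matrix.trace (PS p * H)) = Matrix.trace (PS p * H) := by
    have := Matrix.trace_conjTranspose (PS p * H)
    rw [Matrix.conjTranspose_mul, hH.eq, PS_herm, Matrix.trace_mul_comm] at this
    exact this.symm
  rw [Complex.conj_eq_iff_re] at h
  unfold coef
  push_cast
  rw [h]
  field_simp

lemma expand {n : ℕ} (H : QM n) (hH : H.IsHermitian) : ∑ p, (coef H p : ℂ) • PS p = H := by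
  ext u v
  have h2 : (2:ℂ)^n ≠ 0 := by positivity
  apply mul_left_cancel₀ h2
  rw [Matrix.sum_apply, Finset.mul_sum]
  simp only [Matrix.smul_apply, smul_eq_mul, ← mul_assoc, ← coef_eq H hH]
  simp only [Matrix.trace, Matrix.diag_apply, Matrix.mul_apply, Finset.sum_mul]
  rw [Finset.sum_comm]
  have : ∀ x y : Fin n → Fin 2, ∑ p : Fin n → Fin 4, PS p x y * H y x * PS p u v =
      if x = v ∧ y = u then 2 ^ n * H u v else 0 := by
    intro x y
    have := PS_complete x y u v
    calc _ = (∑ p : Fin n → Fin 4, PS p x y * PS p u v) * H y x := by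
            rw [Finset.sum_mul]; congr 1; ext p; ring
      _ = _ := by
        rw [this]
        split_ifs with h
        · rw [h.1, h.2]
        · simp
  calc _ = ∑ x, ∑ y, ∑ p : Fin n → Fin 4, PS p x y * H y x * PS p u v := by
        congr 1; ext x; rw [Finset.sum_comm]
    _ = _ := by
      simp only [this, ite_and]
      simp

lemma parseval {n : ℕ} (H : QM n) (hH : H.IsHermitian) : ∑ p, coef H p ^ 2 ≤ ‖H‖ ^ 2 := by
  have h1 : Matrix.trace (H * H) = 2 ^ n * ((∑ p, coef H p ^ 2 : ℝ) : ℂ) := by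
    conv_lhs => rw [← expand H hH]
    conv_lhs => arg 1; arg 2; rw [expand H hH]
    rw [Finset.sum_mul, Matrix.trace_sum]
    simp only [smul_mul_assoc, Matrix.trace_smul, coef_eq H hH]
    push_cast
    rw [Finset.mul_sum]
    congr 1; ext p; simp; ring
  have h2 : ‖Matrix.trace (H * H)‖ ≤ 2 ^ n * ‖H‖ ^ 2 := by
    unfold Matrix.trace
    refine (norm_sum_le _ _).trans ?_
    calc _ ≤ ∑ x : Fin n → Fin 2, ‖H‖ ^ 2 := by
          apply Finset.sum_le_sum
          intro x _
          refine (entry_le _ x).trans ?_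
          rw [sq]; exact norm_mul_le _ _
      _ = _ := by simp
  have h0 : 0 ≤ ∑ p, coef H p ^ 2 := Finset.sum_nonneg (fun _ _ => sq_nonneg _)
  rw [h1, norm_mul, norm_pow, Complex.norm_real, Real.norm_of_nonneg h0] at h2
  simp only [Complex.norm_ofNat] at h2
  exact le_of_mul_le_mul_left h2 (by positivity)

/-- **Approximate 2-local decomposition of near-identity unitaries**
(Lemma `lem:pauli-based-decomp`). -/
theorem pauli_based_decomposition :
    ∃ C : ℝ, 0 < C ∧
      ∀ (n : ℕ), 1 ≤ n →
        ∀ H : Matrix (Fin n → Fin 2) (Fin n → Fin 2) ℂ,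
          H.IsHermitian → ‖H‖ < (Real.pi / 16) ^ (2 * n) →
            ∃ (m : ℕ) (U : ℕ → Matrix (Fin n → Fin 2) (Fin n → Fin 2) ℂ),
              (m : ℝ) ≤ (2 : ℝ) ^ (C * (n : ℝ)) ∧
              (∀ i, i < m → IsTwoLocalUnitary (U i)) ∧
              ‖NormedSpace.exp (Complex.I • H) - seqProd U m‖ ≤
                C * ((2 : ℝ) ^ n) ^ 2 * ‖H‖ ^ 2 ∧
              (∑ j ∈ Finset.range m, ‖(1 : Matrix (Fin n → Fin 2) (Fin n → Fin 2) ℂ) - U j‖) ≤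
                C * (n : ℝ) ^ 2 * ((2 : ℝ) ^ n) ^ 2 * ‖H‖ ^ ((1 : ℝ) / (2 * n)) := by
  refine ⟨200, by norm_num, ?_⟩
  intro n hn H hH hε
  have hε0 := norm_nonneg H
  have hε1 : ‖H‖ ≤ 1 := by
    refine hε.le.trans (pow_le_one₀ (by positivity) ?_)
    have := Real.pi_le_four
    linarith
  obtain ⟨δ, hδdef⟩ : ∃ δ, δ = ‖H‖ ^ ((1 : ℝ) / (2 * n)) := ⟨_, rfl⟩
  have hδ0 : 0 ≤ δ := by rw [hδdef]; positivity
  have hδ1 : δ ≤ 1 := by rw [hδdef]; exact Real.rpow_le_one hε0 hε1 (by positivity)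
  have hδn : δ ^ (2 * n) = ‖H‖ := by
    rw [hδdef, ← Real.rpow_natCast, ← Real.rpow_mul hε0]
    push_cast
    rw [one_div_mul_cancel (by positivity), Real.rpow_one]
  rw [← hδdef]
  have hpar := parseval H hH
  have hcoef : ∀ p, |coef H p| ≤ ‖H‖ := by
    intro p
    apply abs_le_of_sq_le_sq _ hε0
    refine le_trans ?_ hpar
    exact Finset.single_le_sum (f := fun p => coef H p ^ 2) (fun _ _ => sq_nonneg _) (Finset.mem_univ p)
  have hg := fun p => pauli_gate hn p (coef H p) δ hδ0 hδ1 (by rw [hδn]; exact hcoef p)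
  choose L hL1 hL2 hL3 using hg
  obtain ⟨U, hU1, hU2⟩ := exists_seq (((Finset.univ : Finset (Fin n → Fin 4)).toList.map L).flatten)
  have hmem : ∀ g ∈ ((Finset.univ : Finset (Fin n → Fin 4)).toList.map L).flatten,
      IsTwoLocalUnitary g ∧ ‖1 - g‖ ≤ 32 * δ := by
    intro g hg
    simp only [List.mem_flatten, List.mem_map] at hg
    obtain ⟨_, ⟨p, _, rfl⟩, hp⟩ := hg
    exact hL3 p g hp
  have hlen : ((Finset.univ : Finset (Fin n → Fin 4)).toList.map L).flatten.length
      ≤ 4 ^ n * (4 * n ^ 2) := by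
    rw [List.length_flatten, List.map_map]
    refine (List.sum_le_card_nsmul _ (4 * n ^ 2) ?_).trans ?_
    · intro x hx
      simp only [List.mem_map] at hx
      obtain ⟨p, _, rfl⟩ := hx
      exact hL2 p
    · simp
  have hlenR : ((((Finset.univ : Finset (Fin n → Fin 4)).toList.map L).flatten.length : ℕ) : ℝ)
      ≤ 4 ^ n * (4 * n ^ 2) := by exact_mod_cast hlen
  have h42 : (4 : ℝ) ^ n = (2 ^ n) ^ 2 := by rw [← pow_mul, mul_comm, pow_mul]; norm_num
  have hprod : ((Finset.univ : Finset (Fin n → Fin 4)).toList.map L).flatten.prod =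
      ((Finset.univ : Finset (Fin n → Fin 4)).toList.map fun p => rot (PS p) (coef H p)).prod := by
    rw [List.prod_flatten, List.map_map]
    congr 1
    apply List.map_congr_left
    intro p _
    exact hL1 p
  refine ⟨_, U, ?_, fun i hi => (hmem _ (hU2 i hi)).1, ?_, ?_⟩
  · refine hlenR.trans ?_
    have hn2 : (n : ℝ) < 2 ^ n := by exact_mod_cast Nat.lt_two_pow_self
    have hn1 : (1 : ℝ) ≤ n := by exact_mod_cast hn
    calc (4 : ℝ) ^ n * (4 * n ^ 2) ≤ 4 ^ n * (4 ^ n * (2 ^ n) ^ 2) := by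
          gcongr
          exact le_self_pow₀ (by norm_num) (by omega)
      _ = 2 ^ (6 * n) := by rw [h42, pow_mul, show (6:ℕ) = 6 from rfl, ← pow_mul, ← pow_mul]; ring
      _ = (2 : ℝ) ^ ((6 * n : ℕ) : ℝ) := by rw [Real.rpow_natCast]
      _ ≤ (2 : ℝ) ^ ((200 : ℝ) * n) := by
          apply Real.rpow_le_rpow_of_exponent_le (by norm_num)
          push_cast
          linarith
  · rw [hU1, hprod]
    have ht := (trotter (coef H) (fun p => (hcoef p).trans hε1) Finset.univ.toList).1
    have e1 : ((Finset.univ : Finset (Fin n → Fin 4)).toList.map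
        fun p => (Complex.I * (coef H p : ℂ)) • PS p).sum = Complex.I • H := by
      rw [Finset.sum_map_toList]
      conv_rhs => rw [← expand H hH]
      rw [Finset.smul_sum]
      simp only [smul_smul]
    rw [e1, Finset.sum_map_toList] at ht
    have hnI : ‖Complex.I • H‖ = ‖H‖ := by rw [norm_smul, Complex.norm_I, one_mul]
    have he := exp_second (Complex.I • H) (by rw [hnI]; exact hε1)
    rw [hnI] at he
    have hcs : (∑ p, |coef H p|) ^ 2 ≤ (2 ^ n) ^ 2 * ‖H‖ ^ 2 := by
      refine (sq_sum_le_card_mul_sum_sq).trans ?_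
      simp only [sq_abs]
      rw [← h42]
      simp only [Finset.card_univ, Fintype.card_pi, Fintype.card_fin, Finset.prod_const]
      push_cast
      gcongr
    have h1 : 1 * ‖H‖ ^ 2 ≤ ((2 : ℝ) ^ n) ^ 2 * ‖H‖ ^ 2 := by
      gcongr
      exact one_le_pow₀ (one_le_pow₀ (by norm_num))
    generalize ((Finset.univ : Finset (Fin n → Fin 4)).toList.map
      fun p => rot (PS p) (coef H p)).prod = W at *
    generalize hE : NormedSpace.exp (Complex.I • H) = E at *
    calc ‖E - W‖ = ‖(E - 1 - Complex.I • H) - (W - 1 - Complex.I • H)‖ := by congr 1; abel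
      _ ≤ ‖E - 1 - Complex.I • H‖ + ‖W - 1 - Complex.I • H‖ := norm_sub_le _ _
      _ ≤ _ := by nlinarith
  · calc _ ≤ ∑ j ∈ Finset.range (((Finset.univ : Finset (Fin n → Fin 4)).toList.map L).flatten.length),
          32 * δ := by
          apply Finset.sum_le_sum
          intro j hj
          exact (hmem _ (hU2 j (Finset.mem_range.1 hj))).2
      _ = (((Finset.univ : Finset (Fin n → Fin 4)).toList.map L).flatten.length : ℕ) * (32 * δ) := by
          rw [Finset.sum_const, Finset.card_range, nsmul_eq_mul]
      _ ≤ (4 ^ n * (4 * n ^ 2)) * (32 * δ) := by gcongr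
      _ = 128 * (n : ℝ) ^ 2 * ((2 : ℝ) ^ n) ^ 2 * δ := by rw [h42]; ring
      _ ≤ 200 * (n : ℝ) ^ 2 * ((2 : ℝ) ^ n) ^ 2 * δ := by gcongr; norm_num
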